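/- Let G=(V,E) be a d-manifold, let ψ:V→ℂ with Re ψ and Im ψ nowhere zero on V, let e be a 2-element subset of U={1+i,1−i,−1+i,−1−i}, and let t1,t2 be the two 3-element subsets of U containing e. Then (i) the union of Ψ^{-1}(t1) and Ψ^{-1}(t2) equals the level set {ψ=0}_e, and (ii) the intersection Ψ^{-1}(t1)∩Ψ^{-1}(t2), which is the subgraph of G1 induced by the simplices on which sign(ψ) attains all four values of U, is either the empty graph or a (d−3)-manifold. -/

import Mathlib

open scoped Classical

/-- A finite simple graph: a finite vertex set together with a symmetric, irreflexive
adjacency relation supported on the vertex set. -/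
structure FGraph (V : Type) where
  verts : Finset V
  Adj : V → V → Prop
  symm : ∀ {a b}, Adj a b → Adj b a
  loopless : ∀ a, ¬ Adj a a
  mem_of_adj : ∀ {a b}, Adj a b → a ∈ verts

namespace FGraph

variable {V W : Type}

/-- The subgraph induced on the vertices satisfying `P`. -/
noncomputable def induce (G : FGraph V) (P : V → Prop) : FGraph V where
  verts := G.verts.filter P
  Adj a b := G.Adj a b ∧ P a ∧ P b
  symm h := ⟨G.symm h.1, h.2.2, h.2.1⟩
  loopless a h := G.loopless a h.1
  mem_of_adj h := Finset.mem_filter.mpr ⟨G.mem_of_adj h.1, h.2.1⟩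

/-- The unit sphere of a vertex: the subgraph induced on its neighbors. -/
noncomputable def unitSphere (G : FGraph V) (v : V) : FGraph V :=
  G.induce (fun w => G.Adj v w)

/-- The graph with the vertex `v` (and its edges) removed. -/
noncomputable def erase (G : FGraph V) (v : V) : FGraph V :=
  G.induce (fun w => w ≠ v)

/-- Inductive definition of contractibility: the one-point graph is contractible, and a
graph is contractible if some vertex has a contractible unit sphere and contractible
complement. -/
inductive Contractible : FGraph V → Prop
  | single (G : FGraph V) (v : V) (h : G.verts = {v}) : Contractible G
  | step (G : FGraph V) (v : V) (hv : v ∈ G.verts)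
      (h1 : Contractible (G.unitSphere v)) (h2 : Contractible (G.erase v)) :
      Contractible G

mutual
  /-- `G` is a `d`-sphere: the empty graph is the `(-1)`-sphere, and a `d`-manifold is a
  `d`-sphere if removing some vertex renders it contractible. -/
  inductive IsSphere : ℤ → FGraph V → Prop
    | empty (G : FGraph V) (h : G.verts = ∅) : IsSphere (-1) G
    | punctured (d : ℤ) (G : FGraph V) (hm : IsManifold d G) (v : V) (hv : v ∈ G.verts)
        (hc : Contractible (G.erase v)) : IsSphere d G
  /-- For `d ≥ 0`, `G` is a `d`-manifold iff every unit sphere is a `(d-1)`-sphere. -/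
  inductive IsManifold : ℤ → FGraph V → Prop
    | intro (d : ℤ) (hd : 0 ≤ d) (G : FGraph V)
        (h : ∀ v ∈ G.verts, IsSphere (d - 1) (G.unitSphere v)) : IsManifold d G
end

/-- A simplex of `G`: the vertex set of a complete subgraph. -/
def IsSimplex (G : FGraph V) (x : Finset V) : Prop :=
  x.Nonempty ∧ ↑x ⊆ G.verts ∧ ∀ a ∈ x, ∀ b ∈ x, a ≠ b → G.Adj a b

/-- The Barycentric refinement: vertices are the simplices of `G`, two being adjacent iff
one is strictly contained in the other. -/
noncomputable def barycentric (G : FGraph V) : FGraph (Finset V) where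
  verts := G.verts.powerset.filter (fun x => G.IsSimplex x)
  Adj x y := G.IsSimplex x ∧ G.IsSimplex y ∧ (x ⊂ y ∨ y ⊂ x)
  symm h := ⟨h.2.1, h.1, h.2.2.symm⟩
  loopless x h := by rcases h.2.2 with h' | h' <;> exact (ssubset_irrefl x h')
  mem_of_adj h := Finset.mem_filter.mpr ⟨Finset.mem_powerset.mpr h.1.2.1, h.1⟩

/-- Number of simplices of `G` with exactly `j` vertices (so `numSimplices G (k+1)` is
the `f`-vector entry `f_k(G)`). -/
noncomputable def numSimplices (G : FGraph V) (j : ℕ) : ℕ :=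
  (G.verts.powerset.filter (fun x => G.IsSimplex x ∧ x.card = j)).card

/-- Euler characteristic `χ(G) = Σ_{k ≥ 0} (-1)^k f_k(G)`, where `f_k` counts the
simplices with `k+1` vertices. -/
noncomputable def euler (G : FGraph V) : ℤ :=
  ∑ k ∈ Finset.range G.verts.card, (-1 : ℤ) ^ k * G.numSimplices (k + 1)

/-- The level set `{f = c}`: the subgraph of the Barycentric refinement induced by the
simplices on which `f - c` changes sign. -/
noncomputable def levelSet (G : FGraph V) (f : V → ℝ) (c : ℝ) : FGraph (Finset V) :=
  G.barycentric.induce (fun x => (∃ a ∈ x, f a - c < 0) ∧ (∃ b ∈ x, 0 < f b - c))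

/-- Graph isomorphism. -/
def Iso (G : FGraph V) (H : FGraph W) : Prop :=
  ∃ φ : V → W, Set.BijOn φ ↑G.verts ↑H.verts ∧
    ∀ a ∈ G.verts, ∀ b ∈ G.verts, (G.Adj a b ↔ H.Adj (φ a) (φ b))

/-- Zykov join of two graphs: disjoint union plus all edges between the two parts. -/
noncomputable def join (G : FGraph V) (H : FGraph W) : FGraph (V ⊕ W) where
  verts := G.verts.disjSum H.verts
  Adj a b :=
    match a, b with
    | .inl a, .inl b => G.Adj a b
    | .inr a, .inr b => H.Adj a b
    | .inl a, .inr b => a ∈ G.verts ∧ b ∈ H.verts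
    | .inr a, .inl b => b ∈ G.verts ∧ a ∈ H.verts
  symm {a b} h := by
    cases a <;> cases b <;> simp_all <;> first | exact G.symm h | exact H.symm h
  loopless a h := by
    cases a <;> simp_all <;> first | exact G.loopless _ h | exact H.loopless _ h
  mem_of_adj {a b} h := by
    cases a <;> cases b <;> simp_all [Finset.mem_disjSum] <;>
      first | exact G.mem_of_adj h | exact H.mem_of_adj h

/-- Union of two graphs on the same vertex type. -/
noncomputable def union (G H : FGraph V) : FGraph V where
  verts := G.verts ∪ H.verts
  Adj a b := G.Adj a b ∨ H.Adj a b
  symm h := h.imp G.symm H.symm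
  loopless a h := h.elim (G.loopless a) (H.loopless a)
  mem_of_adj h :=
    h.elim (fun h' => Finset.mem_union_left _ (G.mem_of_adj h'))
      (fun h' => Finset.mem_union_right _ (H.mem_of_adj h'))

/-- A `d`-ball: a graph of the form `S - v` for a `d`-sphere `S` and a vertex `v` of `S`
(up to graph isomorphism). -/
def IsBall (d : ℤ) (H : FGraph W) : Prop :=
  ∃ (S : FGraph ℕ) (v : ℕ), IsSphere d S ∧ v ∈ S.verts ∧ Iso H (S.erase v)

/-- A `d`-manifold with boundary: every unit sphere is a `(d-1)`-sphere or a `(d-1)`-ball. -/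
def IsManifoldWithBoundary (d : ℤ) (G : FGraph V) : Prop :=
  ∀ v ∈ G.verts, IsSphere (d - 1) (G.unitSphere v) ∨ IsBall (d - 1) (G.unitSphere v)

/-- The cyclic graph `C_n` on the vertex set `Fin n`. -/
def cycleGraph (n : ℕ) : FGraph (Fin n) where
  verts := Finset.univ
  Adj a b := a ≠ b ∧ ((a.val + 1) % n = b.val ∨ (b.val + 1) % n = a.val)
  symm h := ⟨h.1.symm, h.2.symm⟩
  loopless a h := h.1 rfl
  mem_of_adj _ := Finset.mem_univ _

/-- `G` is a disjoint union of cyclic graphs `C_n` with `n ≥ 4`: the vertex set splits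
into pairwise disjoint pieces, edges never cross between pieces, and each piece induces
a graph isomorphic to a `C_n` with `n ≥ 4`. -/
def IsDisjointUnionOfCycles (G : FGraph V) : Prop :=
  ∃ P : Finset (Finset V),
    (∀ S ∈ P, ↑S ⊆ G.verts) ∧
    (∀ S ∈ P, ∀ T ∈ P, S ≠ T → Disjoint S T) ∧
    (∀ v ∈ G.verts, ∃ S ∈ P, v ∈ S) ∧
    (∀ a b, G.Adj a b → ∀ S ∈ P, a ∈ S → b ∈ S) ∧
    (∀ S ∈ P, ∃ n, 4 ≤ n ∧ Iso (G.induce (· ∈ S)) (cycleGraph n))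

/-- Poincaré–Hopf index `i_f(v) = 1 - χ(S^-_f(v))`. -/
noncomputable def pindex (G : FGraph V) (f : V → ℝ) (v : V) : ℤ :=
  1 - ((G.unitSphere v).induce (fun w => f w < f v)).euler

/-- Curvature `K(v) = Σ_{k ≥ 0} (-1)^k f_{k-1}(S(v))/(k+1)` with `f_{-1} = 1`. -/
noncomputable def curvature (G : FGraph V) (v : V) : ℝ :=
  ∑ k ∈ Finset.range (G.verts.card + 1),
    (-1 : ℝ) ^ k * (if k = 0 then 1 else ((G.unitSphere v).numSimplices k : ℝ)) / (k + 1)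

end FGraph

/-- `sign(a + i b) = sign(a) + i sign(b)`. -/
noncomputable def csgn (z : ℂ) : ℂ :=
  ⟨Real.sign z.re, Real.sign z.im⟩

/-- The set `U = {1+i, 1-i, -1+i, -1-i}` of possible values of `csgn`. -/
noncomputable def signU : Finset ℂ :=
  {1 + Complex.I, 1 - Complex.I, -1 + Complex.I, -1 - Complex.I}

namespace FGraph

variable {V : Type}

/-- The set of values of `sign(ψ - c)` attained on the finite vertex set `x`. -/
noncomputable def signValues (ψ : V → ℂ) (c : ℂ) (x : Finset V) : Finset ℂ :=
  x.image (fun v => csgn (ψ v - c))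

/-- The level set `{ψ = c}` of a complex-valued function: the subgraph of the Barycentric
refinement induced by the simplices on which `sign(ψ - c)` takes at least three distinct
values, including `-1+i` and `1-i`. -/
noncomputable def complexLevelSet (G : FGraph V) (ψ : V → ℂ) (c : ℂ) : FGraph (Finset V) :=
  G.barycentric.induce (fun x =>
    3 ≤ (signValues ψ c x).card ∧
    (-1 + Complex.I) ∈ signValues ψ c x ∧ (1 - Complex.I) ∈ signValues ψ c x)

/-- The level set `{ψ = 0}_e` for a two-element subset `e ⊆ U`: the subgraph of the
Barycentric refinement induced by the simplices on which `sign(ψ)` attains both values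
of `e` and at least three distinct values in total. -/
noncomputable def complexLevelSetE (G : FGraph V) (ψ : V → ℂ) (e : Finset ℂ) :
    FGraph (Finset V) :=
  G.barycentric.induce (fun x =>
    (∀ u ∈ e, u ∈ signValues ψ 0 x) ∧ 3 ≤ (signValues ψ 0 x).card)

/-- `Ψ^{-1}(t)`: the subgraph of the Barycentric refinement induced by the simplices on
which `sign(ψ)` attains all values of `t`. -/
noncomputable def signPreimage (G : FGraph V) (ψ : V → ℂ) (t : Finset ℂ) :
    FGraph (Finset V) :=
  G.barycentric.induce (fun x => ∀ u ∈ t, u ∈ signValues ψ 0 x)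

/-- The sign vectors of `F - c` attained on the finite vertex set `x`. -/
noncomputable def vecSignValues {k : ℕ} (F : V → Fin k → ℝ) (c : Fin k → ℝ)
    (x : Finset V) : Finset (Fin k → ℝ) :=
  x.image (fun v j => Real.sign (F v j - c j))

/-- The level set `{F = c}` of an `ℝ^k`-valued function: the subgraph of the Barycentric
refinement induced by the simplices on which the sign vector of `F - c` takes at least
`k+1` distinct values, including the `k` vectors `(1,…,1,-1,1,…,1)`. -/
noncomputable def vecLevelSet (G : FGraph V) {k : ℕ} (F : V → Fin k → ℝ) (c : Fin k → ℝ) :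
    FGraph (Finset V) :=
  G.barycentric.induce (fun x =>
    k + 1 ≤ (vecSignValues F c x).card ∧
    ∀ j : Fin k, (fun i => if i = j then (-1 : ℝ) else 1) ∈ vecSignValues F c x)

end FGraph

/-- The complete graph on `Fin n`. -/
def completeFGraph (n : ℕ) : FGraph (Fin n) where
  verts := Finset.univ
  Adj a b := a ≠ b
  symm h := h.symm
  loopless a h := h rfl
  mem_of_adj _ := Finset.mem_univ _

/-- Stirling numbers of the second kind. -/
def stirling2 : ℕ → ℕ → ℕ
  | 0, 0 => 1
  | 0, _ + 1 => 0
  | _ + 1, 0 => 0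
  | n + 1, m + 1 => (m + 1) * stirling2 n (m + 1) + stirling2 n m

namespace FGraph

variable {V : Type}

lemma ext_of {G H : FGraph V} (h1 : ∀ a, a ∈ G.verts ↔ a ∈ H.verts)
    (h2 : ∀ a b, G.Adj a b ↔ H.Adj a b) : G = H := by
  obtain ⟨v, A, _, _, _⟩ := G
  obtain ⟨w, B, _, _, _⟩ := H
  obtain rfl : v = w := Finset.ext h1
  obtain rfl : A = B := by funext a b; exact propext (h2 a b)
  rfl

lemma mem_of_adj_right (G : FGraph V) {a b : V} (h : G.Adj a b) : b ∈ G.verts :=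
  G.mem_of_adj (G.symm h)

@[simp] lemma mem_induce {G : FGraph V} {P : V → Prop} {a : V} :
    a ∈ (G.induce P).verts ↔ a ∈ G.verts ∧ P a := Finset.mem_filter

@[simp] lemma adj_induce {G : FGraph V} {P : V → Prop} {a b : V} :
    (G.induce P).Adj a b ↔ G.Adj a b ∧ P a ∧ P b := Iff.rfl

@[simp] lemma mem_unitSphere {G : FGraph V} {v a : V} :
    a ∈ (G.unitSphere v).verts ↔ G.Adj v a :=
  mem_induce.trans ⟨And.right, fun h => ⟨G.mem_of_adj_right h, h⟩⟩

@[simp] lemma adj_unitSphere {G : FGraph V} {v a b : V} :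
    (G.unitSphere v).Adj a b ↔ G.Adj a b ∧ G.Adj v a ∧ G.Adj v b := Iff.rfl

@[simp] lemma mem_erase {G : FGraph V} {v a : V} :
    a ∈ (G.erase v).verts ↔ a ∈ G.verts ∧ a ≠ v := mem_induce

@[simp] lemma adj_erase {G : FGraph V} {v a b : V} :
    (G.erase v).Adj a b ↔ G.Adj a b ∧ a ≠ v ∧ b ≠ v := Iff.rfl

lemma card_unitSphere_lt {G : FGraph V} {v : V} (hv : v ∈ G.verts) :
    (G.unitSphere v).verts.card < G.verts.card := by
  refine Finset.card_lt_card ⟨fun a ha => G.mem_of_adj_right (mem_unitSphere.1 ha), fun h => ?_⟩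
  exact G.loopless v (mem_unitSphere.1 (h hv))

lemma card_erase_lt {G : FGraph V} {v : V} (hv : v ∈ G.verts) :
    (G.erase v).verts.card < G.verts.card := by
  refine Finset.card_lt_card ⟨fun a ha => (mem_erase.1 ha).1, fun h => ?_⟩
  exact (mem_erase.1 (h hv)).2 rfl

/-- Spheres unfolded into a single recursion on the dimension. -/
lemma isSphere_iff {d : ℤ} {G : FGraph V} :
    IsSphere d G ↔ (d = -1 ∧ G.verts = ∅) ∨
      (0 ≤ d ∧ (∀ v ∈ G.verts, IsSphere (d - 1) (G.unitSphere v)) ∧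
        ∃ v ∈ G.verts, Contractible (G.erase v)) := by
  constructor
  · intro h
    cases h with
    | empty _ h => exact Or.inl ⟨rfl, h⟩
    | punctured _ _ hm v hv hc =>
      cases hm with
      | intro _ hd _ h => exact Or.inr ⟨hd, h, v, hv, hc⟩
  · rintro (⟨rfl, h⟩ | ⟨hd, h, v, hv, hc⟩)
    · exact .empty G h
    · exact .punctured d G (.intro d hd G h) v hv hc

lemma IsSphere.neg_one_le {d : ℤ} {G : FGraph V} (h : IsSphere d G) : -1 ≤ d := by
  rcases isSphere_iff.1 h with h | h <;> omega

/-- Cones are contractible. -/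
lemma contractible_of_apex (G : FGraph V) (a : V) (ha : a ∈ G.verts)
    (h : ∀ z ∈ G.verts, z ≠ a → G.Adj a z) : Contractible G := by
  induction hn : G.verts.card using Nat.strong_induction_on generalizing G with
  | _ n ih =>
    by_cases hb : ∃ b ∈ G.verts, b ≠ a
    · obtain ⟨b, hb, hba⟩ := hb
      have hab := h b hb hba
      refine .step G b hb (ih _ (hn ▸ card_unitSphere_lt hb) _ ?_ ?_ rfl)
        (ih _ (hn ▸ card_erase_lt hb) _ ?_ ?_ rfl)
      · simpa using G.symm hab
      · intro z hz hza
        have hz := mem_unitSphere.1 hz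
        exact ⟨h z (G.mem_of_adj_right hz) hza, G.symm hab, hz⟩
      · exact mem_erase.2 ⟨ha, hba.symm⟩
      · intro z hz hza
        have hz := mem_erase.1 hz
        exact ⟨h z hz.1 hza, hba.symm, hz.2⟩
    · push Not at hb
      exact .single G a (Finset.eq_singleton_iff_unique_mem.2 ⟨ha, hb⟩)

/-- A join with a contractible factor is contractible. -/
lemma contractible_of_join (G : FGraph V) (P : V → Prop)
    (hj : ∀ a ∈ G.verts, ∀ b ∈ G.verts, P a → ¬ P b → G.Adj a b)
    (h : Contractible (G.induce P)) : Contractible G := by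
  generalize hK : G.induce P = K at h
  induction h generalizing G with
  | single K v h =>
    subst hK
    have hmem : ∀ a, (a ∈ G.verts ∧ P a) ↔ a = v := fun a => by
      rw [← mem_induce, h, Finset.mem_singleton]
    have hv := (hmem v).2 rfl
    exact contractible_of_apex G v hv.1 fun z hz hzv =>
      hj v hv.1 z hz hv.2 fun hPz => hzv ((hmem z).1 ⟨hz, hPz⟩)
  | step K v hv _ _ ih1 ih2 =>
    subst hK
    have hv' := mem_induce.1 hv
    refine .step G v hv'.1 (ih1 _ ?_ (ext_of ?_ ?_)) (ih2 _ ?_ (ext_of ?_ ?_))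
    · intro a ha b hb hPa hPb
      have ha := mem_unitSphere.1 ha
      have hb := mem_unitSphere.1 hb
      exact ⟨hj a (G.mem_of_adj_right ha) b (G.mem_of_adj_right hb) hPa hPb, ha, hb⟩
    · intro a; simp; tauto
    · intro a b; simp; tauto
    · intro a ha b hb hPa hPb
      have ha := mem_erase.1 ha
      have hb := mem_erase.1 hb
      exact ⟨hj a ha.1 b hb.1 hPa hPb, ha.2, hb.2⟩
    · intro a; simp; tauto
    · intro a b; simp; tauto

/-- The join of a `p`-sphere and a `q`-sphere is a `(p+q+1)`-sphere. -/
lemma isSphere_of_join (G : FGraph V) (P : V → Prop) (p q : ℤ)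
    (hj : ∀ a ∈ G.verts, ∀ b ∈ G.verts, P a → ¬ P b → G.Adj a b)
    (hp : IsSphere p (G.induce P)) (hq : IsSphere q (G.induce fun a => ¬ P a)) :
    IsSphere (p + q + 1) G := by
  induction hn : G.verts.card using Nat.strong_induction_on generalizing G p q with
  | _ n ih =>
    rcases isSphere_iff.1 hp with ⟨rfl, hP⟩ | ⟨hp0, hpS, v, hv, hvc⟩
    · have hall : ∀ a ∈ G.verts, ¬ P a := fun a ha hPa => by
        have : a ∈ (G.induce P).verts := mem_induce.2 ⟨ha, hPa⟩
        simp [hP] at this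
      have : G.induce (fun a => ¬ P a) = G := ext_of
        (fun a => mem_induce.trans ⟨And.left, fun h => ⟨h, hall a h⟩⟩)
        (fun a b => adj_induce.trans ⟨And.left, fun h =>
          ⟨h, hall a (G.mem_of_adj h), hall b (G.mem_of_adj_right h)⟩⟩)
      rw [this] at hq
      simpa using hq
    rcases isSphere_iff.1 hq with ⟨rfl, hQ⟩ | ⟨hq0, hqS, -⟩
    · have hall : ∀ a ∈ G.verts, P a := fun a ha => by
        by_contra hPa
        have : a ∈ (G.induce fun a => ¬ P a).verts := mem_induce.2 ⟨ha, hPa⟩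
        simp [hQ] at this
      have : G.induce P = G := ext_of
        (fun a => mem_induce.trans ⟨And.left, fun h => ⟨h, hall a h⟩⟩)
        (fun a b => adj_induce.trans ⟨And.left, fun h =>
          ⟨h, hall a (G.mem_of_adj h), hall b (G.mem_of_adj_right h)⟩⟩)
      rw [this] at hp
      simpa using hp
    have hjS : ∀ w, ∀ a ∈ (G.unitSphere w).verts, ∀ b ∈ (G.unitSphere w).verts,
        P a → ¬ P b → (G.unitSphere w).Adj a b := by
      intro w a ha b hb hPa hPb
      have ha := mem_unitSphere.1 ha
      have hb := mem_unitSphere.1 hb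
      exact ⟨hj a (G.mem_of_adj_right ha) b (G.mem_of_adj_right hb) hPa hPb, ha, hb⟩
    refine isSphere_iff.2 (Or.inr ⟨by omega, fun w hw => ?_, v, (mem_induce.1 hv).1, ?_⟩)
    · by_cases hPw : P w
      · have key := ih _ (hn ▸ card_unitSphere_lt hw) (G.unitSphere w) (p - 1) q (hjS w) ?_ ?_ rfl
        · convert key using 1; ring
        · convert hpS w (mem_induce.2 ⟨hw, hPw⟩) using 1
          apply ext_of
          · intro a; simp; tauto
          · intro a b; simp; tauto
        · convert hq using 1
          have hadj : ∀ a ∈ G.verts, ¬ P a → G.Adj w a := fun a ha hPa => hj w hw a ha hPw hPa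
          apply ext_of
          · intro a
            simp only [mem_induce, mem_unitSphere]
            exact ⟨fun h => ⟨G.mem_of_adj_right h.1, h.2⟩, fun h => ⟨hadj a h.1 h.2, h.2⟩⟩
          · intro a b
            simp only [adj_induce, adj_unitSphere]
            exact ⟨fun h => ⟨h.1.1, h.2⟩, fun h => ⟨⟨h.1, hadj a (G.mem_of_adj h.1) h.2.1,
              hadj b (G.mem_of_adj_right h.1) h.2.2⟩, h.2⟩⟩
      · have key := ih _ (hn ▸ card_unitSphere_lt hw) (G.unitSphere w) p (q - 1) (hjS w) ?_ ?_ rfl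
        · convert key using 1; ring
        · convert hp using 1
          have hadj : ∀ a ∈ G.verts, P a → G.Adj w a :=
            fun a ha hPa => G.symm (hj a ha w hw hPa hPw)
          apply ext_of
          · intro a
            simp only [mem_induce, mem_unitSphere]
            exact ⟨fun h => ⟨G.mem_of_adj_right h.1, h.2⟩, fun h => ⟨hadj a h.1 h.2, h.2⟩⟩
          · intro a b
            simp only [adj_induce, adj_unitSphere]
            exact ⟨fun h => ⟨h.1.1, h.2⟩, fun h => ⟨⟨h.1, hadj a (G.mem_of_adj h.1) h.2.1,
              hadj b (G.mem_of_adj_right h.1) h.2.2⟩, h.2⟩⟩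
        · convert hqS w (mem_induce.2 ⟨hw, hPw⟩) using 1
          apply ext_of
          · intro a; simp; tauto
          · intro a b; simp; tauto
    · refine contractible_of_join (G.erase v) P ?_ ?_
      · intro a ha b hb hPa hPb
        have ha := mem_erase.1 ha
        have hb := mem_erase.1 hb
        exact ⟨hj a ha.1 b hb.1 hPa hPb, ha.2, hb.2⟩
      · convert hvc using 1
        apply ext_of
        · intro a; simp; tauto
        · intro a b; simp; tauto

/-- If the vertices satisfying `D`, taken in order of decreasing rank `r`, have conical unit
spheres (with apex outside `D`), then removing all of them does not affect contractibility. -/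
lemma contractible_of_induce_not (G : FGraph V) (D : V → Prop) (r : V → ℤ)
    (hD : ∀ y ∈ G.verts, D y → ∃ a, ¬ D a ∧ G.Adj y a ∧
      ∀ z, G.Adj y z → (D z → r z ≤ r y) → z ≠ a → G.Adj a z)
    (h : Contractible (G.induce fun a => ¬ D a)) : Contractible G := by
  induction hn : G.verts.card using Nat.strong_induction_on generalizing G with
  | _ n ih =>
    by_cases hne : (G.verts.filter D).Nonempty
    · obtain ⟨y, hy, hmax⟩ := Finset.exists_max_image _ r hne
      obtain ⟨hy, hDy⟩ := Finset.mem_filter.1 hy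
      obtain ⟨a, hDa, hya, ha⟩ := hD y hy hDy
      refine .step G y hy (contractible_of_apex _ a (mem_unitSphere.2 hya) fun z hz hza => ?_)
        (ih _ (hn ▸ card_erase_lt hy) _ ?_ ?_ rfl)
      · have hz := mem_unitSphere.1 hz
        exact ⟨ha z hz (fun hDz => hmax z (Finset.mem_filter.2 ⟨G.mem_of_adj_right hz, hDz⟩)) hza,
          hya, hz⟩
      · intro z hz hDz
        obtain ⟨hz, hzy⟩ := mem_erase.1 hz
        obtain ⟨b, hDb, hzb, hb⟩ := hD z hz hDz
        have hby : b ≠ y := fun h => hDb (h ▸ hDy)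
        exact ⟨b, hDb, ⟨hzb, hzy, hby⟩, fun w hw hr hwb => ⟨hb w hw.1 hr hwb, hby, hw.2.2⟩⟩
      · convert h using 1
        have hyD : ∀ a, ¬ D a → a ≠ y := fun a h h' => h (h' ▸ hDy)
        apply ext_of
        · intro a
          simp only [mem_induce, mem_erase]
          exact ⟨fun h => ⟨h.1.1, h.2⟩, fun h => ⟨⟨h.1, hyD a h.2⟩, h.2⟩⟩
        · intro a b
          simp only [adj_induce, adj_erase]
          exact ⟨fun h => ⟨h.1.1, h.2⟩, fun h => ⟨⟨h.1, hyD a h.2.1, hyD b h.2.2⟩, h.2⟩⟩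
    · have hall : ∀ a ∈ G.verts, ¬ D a := fun a ha hDa => hne ⟨a, Finset.mem_filter.2 ⟨ha, hDa⟩⟩
      have : G.induce (fun a => ¬ D a) = G := ext_of
        (fun a => mem_induce.trans ⟨And.left, fun h => ⟨h, hall a h⟩⟩)
        (fun a b => adj_induce.trans ⟨And.left, fun h =>
          ⟨h, hall a (G.mem_of_adj h), hall b (G.mem_of_adj_right h)⟩⟩)
      rwa [this] at h

/-- The comparability graph of a finite family of finite sets ordered by inclusion. -/
def compGraph (F : Finset (Finset V)) : FGraph (Finset V) where
  verts := F
  Adj a b := a ∈ F ∧ b ∈ F ∧ (a ⊂ b ∨ b ⊂ a)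
  symm h := ⟨h.2.1, h.1, h.2.2.symm⟩
  loopless a h := h.2.2.elim (ssubset_irrefl a) (ssubset_irrefl a)
  mem_of_adj h := h.1

@[simp] lemma mem_compGraph {F : Finset (Finset V)} {a : Finset V} :
    a ∈ (compGraph F).verts ↔ a ∈ F := Iff.rfl

@[simp] lemma adj_compGraph {F : Finset (Finset V)} {a b : Finset V} :
    (compGraph F).Adj a b ↔ a ∈ F ∧ b ∈ F ∧ (a ⊂ b ∨ b ⊂ a) := Iff.rfl

lemma compGraph_induce (F : Finset (Finset V)) (P : Finset V → Prop) [DecidablePred P] :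
    (compGraph F).induce P = compGraph (F.filter P) := by
  apply ext_of
  · intro a; simp
  · intro a b; simp; tauto

lemma compGraph_erase (F : Finset (Finset V)) (y : Finset V) :
    (compGraph F).erase y = compGraph (F.erase y) := by
  apply ext_of
  · intro a; simp; tauto
  · intro a b; simp; tauto

lemma compGraph_unitSphere {F : Finset (Finset V)} {y : Finset V} (hy : y ∈ F) :
    (compGraph F).unitSphere y = compGraph (F.filter fun z => z ⊂ y ∨ y ⊂ z) := by
  apply ext_of
  · intro a; simp; tauto
  · intro a b; simp; tauto

/-- The unit sphere of `y` in a comparability graph is the join of the parts below and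
above `y`. -/
lemma isSphere_compGraph_unitSphere {F : Finset (Finset V)} {y : Finset V} (hy : y ∈ F)
    {p q : ℤ} (hp : IsSphere p (compGraph (F.filter fun z => z ⊂ y)))
    (hq : IsSphere q (compGraph (F.filter fun z => y ⊂ z))) :
    IsSphere (p + q + 1) ((compGraph F).unitSphere y) := by
  rw [compGraph_unitSphere hy]
  refine isSphere_of_join _ (fun z => z ⊂ y) p q ?_ ?_ ?_
  · intro a ha b hb hay hby
    have hb' := (Finset.mem_filter.1 hb).2.resolve_left hby
    exact ⟨ha, hb, Or.inl (hay.trans hb')⟩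
  · rw [compGraph_induce]
    convert hp using 2
    ext z; simp; tauto
  · rw [compGraph_induce]
    convert hq using 2
    ext z
    simp only [Finset.mem_filter]
    exact ⟨fun h => ⟨h.1.1, h.1.2.resolve_left h.2⟩,
      fun h => ⟨⟨h.1, Or.inr h.2⟩, fun h' => ssubset_irrefl _ (h.2.trans h')⟩⟩

/-- The proper subsets of `x` that attain all the colors occurring in `x`. -/
noncomputable def colorFaces {W : Type} (c : V → W) (x : Finset V) : Finset (Finset V) :=
  x.powerset.filter fun y => y ≠ x ∧ ∀ a ∈ x, ∃ b ∈ y, c b = c a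

lemma mem_colorFaces {W : Type} {c : V → W} {x y : Finset V} :
    y ∈ colorFaces c x ↔ y ⊆ x ∧ y ≠ x ∧ ∀ a ∈ x, ∃ b ∈ y, c b = c a := by
  simp [colorFaces]

/-- The coloring for which all points of `y` have their own color and all other points
share one color. -/
noncomputable def intervalColor (y : Finset V) (a : V) : Option V :=
  if a ∈ y then some a else none

lemma mem_colorFaces_intervalColor {x y z : Finset V} (hyx : y ⊂ x) :
    z ∈ colorFaces (intervalColor y) x ↔ y ⊂ z ∧ z ⊂ x := by
  rw [mem_colorFaces]
  constructor
  · rintro ⟨h1, h2, h3⟩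
    obtain ⟨w, hw, hwy⟩ := Finset.exists_of_ssubset hyx
    refine ⟨⟨fun a ha => ?_, fun hzy => ?_⟩, h1.ssubset_of_ne h2⟩
    · obtain ⟨b, hb, hba⟩ := h3 a (hyx.1 ha)
      simp only [intervalColor, ha, if_true] at hba
      split_ifs at hba
      cases hba
      exact hb
    · obtain ⟨b, hb, hba⟩ := h3 w hw
      simp [intervalColor, hwy, hzy hb] at hba
  · rintro ⟨h1, h2⟩
    refine ⟨h2.1, h2.ne, fun a ha => ?_⟩
    by_cases hay : a ∈ y
    · exact ⟨a, h1.1 hay, rfl⟩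
    · obtain ⟨w, hw, hwy⟩ := Finset.exists_of_ssubset h1
      exact ⟨w, hw, by simp [intervalColor, hwy, hay]⟩

lemma card_image_intervalColor {_ : DecidableEq (Option V)} {x y : Finset V} (hyx : y ⊂ x) :
    (x.image (intervalColor y)).card = y.card + 1 := by
  have : x.image (intervalColor y) = insert none (y.image some) := by
    obtain ⟨w, hw, hwy⟩ := Finset.exists_of_ssubset hyx
    ext o
    simp only [Finset.mem_image, Finset.mem_insert]
    constructor
    · rintro ⟨a, _, rfl⟩
      by_cases h : a ∈ y <;> simp [intervalColor, h]
    · rintro (rfl | ⟨a, ha, rfl⟩)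
      · exact ⟨w, hw, by simp [intervalColor, hwy]⟩
      · exact ⟨a, hyx.1 ha, by simp [intervalColor, ha]⟩
  rw [this, Finset.card_insert_of_notMem (by simp),
    Finset.card_image_of_injective _ (Option.some_injective V)]

/-- Given two points `v ≠ w` of `x` of the same color, puncturing `colorFaces c x` at
`x.erase v` leaves a contractible graph. -/
lemma contractible_colorFaces_erase {W : Type} (c : V → W) (x : Finset V) {v w : V}
    (hv : v ∈ x) (hw : w ∈ x) (hvw : v ≠ w) (hc : c v = c w) :
    Contractible (compGraph ((colorFaces c x).erase (x.erase v))) := by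
  set F := (colorFaces c x).erase (x.erase v) with hF
  have memF : ∀ {y}, y ∈ F ↔ y ≠ x.erase v ∧ y ⊆ x ∧ y ≠ x ∧ ∀ a ∈ x, ∃ b ∈ y, c b = c a :=
    fun {y} => by rw [hF, Finset.mem_erase, mem_colorFaces]
  refine contractible_of_induce_not _ (fun y => v ∉ y) (fun y => y.card) ?_ ?_
  · intro y hy hvy
    have hyF := hy
    obtain ⟨h0, h1, h2, h3⟩ := memF.1 (mem_compGraph.1 hy)
    have haF : insert v y ∈ F := by
      refine memF.2 ⟨fun h => ?_, Finset.insert_subset hv h1, fun h => h0 ?_, fun a ha => ?_⟩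
      · have : v ∈ x.erase v := h ▸ Finset.mem_insert_self v y
        simp at this
      · rw [← h, Finset.erase_insert hvy]
      · obtain ⟨b, hb, hba⟩ := h3 a ha
        exact ⟨b, Finset.mem_insert_of_mem hb, hba⟩
    have hya : y ⊂ insert v y := Finset.ssubset_insert hvy
    refine ⟨insert v y, by simp, ⟨hyF, haF, Or.inl hya⟩, ?_⟩
    rintro z ⟨-, hz, hyz⟩ hr hne
    refine ⟨haF, hz, ?_⟩
    rcases hyz with hyz | hzy
    · have hvz : v ∈ z := by
        by_contra hvz
        have := hr hvz
        have := Finset.card_lt_card hyz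
        omega
      exact Or.inl ((Finset.insert_subset hvz hyz.1).ssubset_of_ne hne.symm)
    · exact Or.inr (hzy.trans hya)
  rw [compGraph_induce]
  set m := x.filter fun a => c a = c v → a = v with hm
  have hwm : w ∉ m := fun h => hvw ((Finset.mem_filter.1 h).2 hc.symm).symm
  have hvm : v ∈ m := Finset.mem_filter.2 ⟨hv, fun _ => rfl⟩
  set F2 := F.filter fun y => ¬ v ∉ y with hF2
  have memF2 : ∀ {y}, y ∈ F2 ↔ y ∈ F ∧ v ∈ y := fun {y} => by simp [hF2]
  have hcap : ∀ y ⊆ x, v ∈ y → (∀ a ∈ x, ∃ b ∈ y, c b = c a) → y ∩ m ∈ F2 := by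
    intro y hyx hvy h
    refine memF2.2 ⟨memF.2 ⟨fun h => ?_, fun a ha => hyx (Finset.mem_inter.1 ha).1,
      fun h => ?_, fun a ha => ?_⟩, Finset.mem_inter.2 ⟨hvy, hvm⟩⟩
    · have : v ∈ x.erase v := h ▸ Finset.mem_inter.2 ⟨hvy, hvm⟩
      simp at this
    · rw [← h] at hw
      exact hwm (Finset.mem_inter.1 hw).2
    · obtain ⟨b, hb, hba⟩ := h a ha
      by_cases hbv : c b = c v
      · exact ⟨v, Finset.mem_inter.2 ⟨hvy, hvm⟩, hbv.symm.trans hba⟩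
      · exact ⟨b, Finset.mem_inter.2 ⟨hb, Finset.mem_filter.2 ⟨hyx hb, fun h => absurd h hbv⟩⟩, hba⟩
  refine contractible_of_induce_not _ (fun y => ¬ y ⊆ m) (fun y => -(y.card : ℤ)) ?_ ?_
  · intro y hy hym
    obtain ⟨hyF, hvy⟩ := memF2.1 (mem_compGraph.1 hy)
    obtain ⟨h0, h1, h2, h3⟩ := memF.1 hyF
    have haF := hcap y h1 hvy h3
    have hay : y ∩ m ⊂ y := ⟨Finset.inter_subset_left,
      fun h => hym fun a ha => (Finset.mem_inter.1 (h ha)).2⟩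
    refine ⟨y ∩ m, by simp, ⟨hy, haF, Or.inr hay⟩, ?_⟩
    rintro z ⟨-, hz, hyz⟩ hr hne
    refine ⟨haF, hz, ?_⟩
    rcases hyz with hyz | hzy
    · exact Or.inl (hay.trans hyz)
    · have hzm : z ⊆ m := by
        by_contra hzm
        have := hr hzm
        have := Finset.card_lt_card hzy
        omega
      exact Or.inr ((Finset.subset_inter hzy.1 hzm).ssubset_of_ne hne)
  rw [compGraph_induce]
  have hmx : m ⊆ x := Finset.filter_subset _ _
  have hmF : m ∈ F2.filter fun y => ¬ ¬ y ⊆ m := by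
    have := hcap x subset_rfl hv fun a ha => ⟨a, ha, rfl⟩
    rw [Finset.inter_eq_right.2 hmx] at this
    exact Finset.mem_filter.2 ⟨this, by simp⟩
  refine contractible_of_apex _ m hmF fun z hz hzm => ⟨hmF, hz, Or.inr ?_⟩
  exact (not_not.1 (Finset.mem_filter.1 hz).2).ssubset_of_ne hzm

/-- If `x` carries exactly `|x| - n` colors, then `colorFaces c x` is an `(n-1)`-sphere. -/
lemma isSphere_colorFaces (n : ℕ) : ∀ {W : Type} (c : V → W) (x : Finset V),
    x.card = (x.image c).card + n → IsSphere ((n : ℤ) - 1) (compGraph (colorFaces c x)) := by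
  induction n using Nat.strong_induction_on with
  | _ n ih =>
    intro W c x hn
    rcases Nat.eq_zero_or_pos n with rfl | hpos
    · refine isSphere_iff.2 (Or.inl ⟨by simp, Finset.eq_empty_of_forall_notMem fun y hy => ?_⟩)
      have hinj := Finset.card_image_iff.1 hn.symm
      obtain ⟨h1, h2, h3⟩ := mem_colorFaces.1 (mem_compGraph.1 hy)
      refine h2 (h1.antisymm fun a ha => ?_)
      obtain ⟨b, hb, hba⟩ := h3 a ha
      exact hinj (h1 hb) ha hba ▸ hb
    · obtain ⟨v, hv, w, hw, hvw, hc⟩ : ∃ v ∈ x, ∃ w ∈ x, v ≠ w ∧ c v = c w :=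
        Finset.exists_ne_map_eq_of_card_lt_of_maps_to (t := x.image c) (by omega)
          fun a ha => Finset.mem_image_of_mem c ha
      refine isSphere_iff.2 (Or.inr ⟨by omega, fun y hy => ?_, x.erase v, ?_, ?_⟩)
      · have hy := mem_compGraph.1 hy
        obtain ⟨h1, h2, h3⟩ := mem_colorFaces.1 hy
        have hyx := h1.ssubset_of_ne h2
        have hlt := Finset.card_lt_card hyx
        have himg : y.image c = x.image c := by
          refine (Finset.image_subset_image h1).antisymm fun u hu => ?_
          obtain ⟨a, ha, rfl⟩ := Finset.mem_image.1 hu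
          obtain ⟨b, hb, hba⟩ := h3 a ha
          exact Finset.mem_image.2 ⟨b, hb, hba⟩
        have hle : (y.image c).card ≤ y.card := Finset.card_image_le
        rw [himg] at hle
        obtain ⟨k, hk⟩ := Nat.exists_eq_add_of_le hle
        obtain ⟨l, hl⟩ := Nat.exists_eq_add_of_lt hlt
        have hlow := ih k (by omega) c y (by rw [himg, hk])
        have hup := ih l (by omega) (intervalColor y) x
          (by rw [card_image_intervalColor hyx]; omega)
        have key := isSphere_compGraph_unitSphere hy (p := (k : ℤ) - 1) (q := (l : ℤ) - 1) ?_ ?_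
        · convert key using 1; omega
        · convert hlow using 2
          ext z
          simp only [Finset.mem_filter, mem_colorFaces]
          constructor
          · rintro ⟨⟨_, _, h⟩, hzy⟩
            exact ⟨hzy.1, hzy.ne, fun a ha => h a (h1 ha)⟩
          · rintro ⟨hzy, hne, h⟩
            refine ⟨⟨hzy.trans h1, (hzy.trans_ssubset hyx).ne, fun a ha => ?_⟩,
              hzy.ssubset_of_ne hne⟩
            obtain ⟨b, hb, hba⟩ := h3 a ha
            obtain ⟨b', hb', hbb⟩ := h b hb
            exact ⟨b', hb', hbb.trans hba⟩
        · convert hup using 2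
          ext z
          rw [mem_colorFaces_intervalColor hyx, Finset.mem_filter, mem_colorFaces]
          constructor
          · rintro ⟨⟨h1, h2, _⟩, hyz⟩
            exact ⟨hyz, h1.ssubset_of_ne h2⟩
          · rintro ⟨hyz, hzx⟩
            refine ⟨⟨hzx.1, hzx.ne, fun a ha => ?_⟩, hyz⟩
            obtain ⟨b, hb, hba⟩ := h3 a ha
            exact ⟨b, hyz.1 hb, hba⟩
      · refine mem_colorFaces.2 ⟨Finset.erase_subset _ _, (Finset.erase_ssubset hv).ne,
          fun a ha => ?_⟩
        by_cases hav : a = v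
        · exact ⟨w, Finset.mem_erase.2 ⟨hvw.symm, hw⟩, by rw [hav, hc]⟩
        · exact ⟨a, Finset.mem_erase.2 ⟨hav, ha⟩, rfl⟩
      · rw [compGraph_erase]
        exact contractible_colorFaces_erase c x hv hw hvw hc

lemma isSphere_interval {x y : Finset V} (hyx : y ⊂ x) :
    IsSphere ((x.card : ℤ) - y.card - 2) (compGraph (colorFaces (intervalColor y) x)) := by
  obtain ⟨l, hl⟩ := Nat.exists_eq_add_of_lt (Finset.card_lt_card hyx)
  convert isSphere_colorFaces l (intervalColor y) x
    (by rw [card_image_intervalColor hyx]; omega) using 1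
  omega

/-- The common neighborhood of the points of `x`. -/
noncomputable def link (G : FGraph V) (x : Finset V) : FGraph V :=
  G.induce fun w => ∀ a ∈ x, G.Adj a w

/-- `x` is a possibly empty clique of `G`. -/
def IsFace (G : FGraph V) (x : Finset V) : Prop :=
  x ⊆ G.verts ∧ ∀ a ∈ x, ∀ b ∈ x, a ≠ b → G.Adj a b

lemma mem_link {G : FGraph V} {x : Finset V} {v : V} :
    v ∈ (G.link x).verts ↔ v ∈ G.verts ∧ ∀ a ∈ x, G.Adj a v := mem_induce

lemma notMem_of_mem_link {G : FGraph V} {x : Finset V} {v : V} (hv : v ∈ (G.link x).verts) :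
    v ∉ x := fun h => G.loopless v ((mem_link.1 hv).2 v h)

lemma link_insert {G : FGraph V} {x : Finset V} {v : V} (hv : v ∈ (G.link x).verts) :
    G.link (insert v x) = (G.link x).unitSphere v := by
  have hv' := (mem_link.1 hv).2
  apply ext_of
  · intro a
    simp only [link, mem_induce, mem_unitSphere, adj_induce, Finset.forall_mem_insert]
    exact ⟨fun h => ⟨h.2.1, hv', h.2.2⟩, fun h => ⟨G.mem_of_adj_right h.1, h.1, h.2.2⟩⟩
  · intro a b
    simp only [link, adj_unitSphere, adj_induce, Finset.forall_mem_insert]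
    tauto

lemma link_erase {G : FGraph V} {x : Finset V} {v : V} (hv : v ∉ x) :
    (G.erase v).link x = (G.link x).erase v := by
  have hx : ∀ a ∈ x, a ≠ v := fun a ha h => hv (h ▸ ha)
  apply ext_of
  · intro w
    simp only [link, mem_induce, mem_erase, adj_erase]
    exact ⟨fun h => ⟨⟨h.1.1, fun a ha => (h.2 a ha).1⟩, h.1.2⟩,
      fun h => ⟨⟨h.1.1, h.2⟩, fun a ha => ⟨h.1.2 a ha, hx a ha, h.2⟩⟩⟩
  · intro w z
    simp only [link, adj_induce, adj_erase]
    exact ⟨fun h => ⟨⟨h.1.1, fun a ha => (h.2.1 a ha).1, fun a ha => (h.2.2 a ha).1⟩, h.1.2⟩,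
      fun h => ⟨⟨h.1.1, h.2⟩, fun a ha => ⟨h.1.2.1 a ha, hx a ha, h.2.1⟩,
        fun a ha => ⟨h.1.2.2 a ha, hx a ha, h.2.2⟩⟩⟩

lemma IsFace.insert {G : FGraph V} {x : Finset V} {v : V} (hx : G.IsFace x)
    (hv : v ∈ (G.link x).verts) : G.IsFace (insert v x) := by
  obtain ⟨h1, h2⟩ := mem_link.1 hv
  refine ⟨Finset.insert_subset h1 hx.1, fun a ha b hb hab => ?_⟩
  rcases Finset.mem_insert.1 ha with rfl | ha' <;> rcases Finset.mem_insert.1 hb with rfl | hb'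
  · exact absurd rfl hab
  · exact G.symm (h2 b hb')
  · exact h2 a ha'
  · exact hx.2 a ha' b hb' hab

lemma IsFace.erase {G : FGraph V} {x : Finset V} {v : V} (hx : G.IsFace x) (hv : v ∉ x) :
    (G.erase v).IsFace x := by
  have hne : ∀ a ∈ x, a ≠ v := fun a ha h => hv (h ▸ ha)
  exact ⟨fun a ha => mem_erase.2 ⟨hx.1 ha, hne a ha⟩,
    fun a ha b hb hab => ⟨hx.2 a ha b hb hab, hne a ha, hne b hb⟩⟩

/-- Links of larger faces inside a spherical link are spheres of the expected dimension. -/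
lemma isSphere_link_of_subset {G : FGraph V} (n : ℕ) : ∀ (d : ℤ) (x y : Finset V), x ⊆ y →
    G.IsFace y → y.card = x.card + n → IsSphere d (G.link x) → IsSphere (d - n) (G.link y) := by
  induction n with
  | zero =>
    intro d x y hxy _ hn h
    obtain rfl := Finset.eq_of_subset_of_card_le hxy (by omega)
    simpa using h
  | succ n ih =>
    intro d x y hxy hy hn h
    obtain ⟨v, hv, hvx⟩ := Finset.exists_of_ssubset
      (hxy.ssubset_of_ne fun h => by rw [h] at hn; omega)
    have hvl : v ∈ (G.link x).verts := mem_link.2 ⟨hy.1 hv, fun a ha =>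
      hy.2 a (hxy ha) v hv fun h => hvx (h ▸ ha)⟩
    have hs : IsSphere (d - 1) (G.link (insert v x)) := by
      rw [link_insert hvl]
      rcases isSphere_iff.1 h with ⟨_, h⟩ | ⟨_, h, _⟩
      · rw [h] at hvl; simp at hvl
      · exact h v hvl
    have := ih (d - 1) (insert v x) y (Finset.insert_subset hv hxy) hy
      (by rw [Finset.card_insert_of_notMem hvx]; omega) hs
    convert this using 1
    push_cast; ring

lemma IsManifold.isSphere_link {G : FGraph V} {d : ℤ} (hG : IsManifold d G) {x : Finset V}
    (hx : G.IsSimplex x) : IsSphere (d - x.card) (G.link x) := by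
  obtain ⟨v, hv⟩ := hx.1
  have h1 : IsSphere (d - 1) (G.link {v}) := by
    have : G.link {v} = G.unitSphere v := by simp [link, unitSphere]
    rw [this]
    cases hG with
    | intro _ _ _ h => exact h v (hx.2.1 hv)
  have hpos : 0 < x.card := Finset.card_pos.2 hx.1
  have := isSphere_link_of_subset (x.card - 1) (d - 1) {v} x (by simpa using hv) hx.2
    (by simp; omega) h1
  convert this using 1
  omega

/-- The simplices of `G` strictly containing `x`. -/
noncomputable def starFaces (G : FGraph V) (x : Finset V) : Finset (Finset V) :=
  G.verts.powerset.filter fun y => x ⊂ y ∧ G.IsSimplex y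

lemma mem_starFaces {G : FGraph V} {x y : Finset V} :
    y ∈ G.starFaces x ↔ x ⊂ y ∧ G.IsFace y := by
  simp only [starFaces, Finset.mem_filter, Finset.mem_powerset]
  exact ⟨fun h => ⟨h.2.1, h.2.2.2⟩, fun h => ⟨h.2.1, h.1,
    (Finset.exists_of_ssubset h.1).imp fun _ h => h.1, h.2⟩⟩

lemma mem_link_of_mem_starFaces {G : FGraph V} {x y : Finset V} (hy : y ∈ G.starFaces x) {v : V}
    (hv : v ∈ y) (hvx : v ∉ x) : v ∈ (G.link x).verts := by
  obtain ⟨h1, h2⟩ := mem_starFaces.1 hy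
  exact mem_link.2 ⟨h2.1 hv, fun a ha => h2.2 a (h1.1 ha) v hv fun h => hvx (h ▸ ha)⟩

lemma insert_mem_starFaces {G : FGraph V} {x : Finset V} (hx : G.IsFace x) {v : V}
    (hv : v ∈ (G.link x).verts) : insert v x ∈ G.starFaces x :=
  mem_starFaces.2 ⟨Finset.ssubset_insert (notMem_of_mem_link hv), hx.insert hv⟩

lemma contractible_starFaces_erase {G : FGraph V} {x : Finset V} {v : V}
    (hv : v ∈ (G.link x).verts) (h : Contractible (compGraph ((G.erase v).starFaces x))) :
    Contractible (compGraph ((G.starFaces x).erase (insert v x))) := by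
  have hvx := notMem_of_mem_link hv
  refine contractible_of_induce_not _ (fun y => v ∈ y) (fun y => -(y.card : ℤ)) ?_ ?_
  · intro y hy hvy
    obtain ⟨hne, hyS⟩ := Finset.mem_erase.1 (mem_compGraph.1 hy)
    obtain ⟨hxy, hyF⟩ := mem_starFaces.1 hyS
    have hay := Finset.erase_ssubset hvy
    have haF : y.erase v ∈ (G.starFaces x).erase (insert v x) := by
      refine Finset.mem_erase.2 ⟨fun h => ?_, mem_starFaces.2 ⟨?_, hay.1.trans hyF.1, ?_⟩⟩
      · have : v ∈ y.erase v := h ▸ Finset.mem_insert_self v x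
        simp at this
      · refine Finset.ssubset_iff_subset_ne.2 ⟨fun a ha => Finset.mem_erase.2
          ⟨fun h => hvx (h ▸ ha), hxy.1 ha⟩, fun h => hne ?_⟩
        rw [h, Finset.insert_erase hvy]
      · exact fun a ha b hb hab => hyF.2 a (hay.1 ha) b (hay.1 hb) hab
    refine ⟨y.erase v, by simp, ⟨hy, haF, Or.inr hay⟩, ?_⟩
    rintro z ⟨-, hz, hyz⟩ hr hne
    refine ⟨haF, hz, ?_⟩
    rcases hyz with hyz | hzy
    · exact Or.inl (hay.trans hyz)
    · have hvz : v ∉ z := by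
        intro hvz
        have := hr hvz
        have := Finset.card_lt_card hzy
        omega
      exact Or.inr ((Finset.subset_erase.2 ⟨hzy.1, hvz⟩).ssubset_of_ne hne)
  · rw [compGraph_induce]
    convert h using 2
    ext y
    simp only [Finset.mem_filter, Finset.mem_erase, mem_starFaces]
    constructor
    · rintro ⟨⟨_, hxy, hy⟩, hvy⟩
      exact ⟨hxy, hy.erase hvy⟩
    · rintro ⟨hxy, hy⟩
      have hvy : v ∉ y := fun h => (mem_erase.1 (hy.1 h)).2 rfl
      exact ⟨⟨fun h => hvy (h ▸ Finset.mem_insert_self v x), hxy,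
        fun a ha => (mem_erase.1 (hy.1 ha)).1, fun a ha b hb hab => (hy.2 a ha b hb hab).1⟩, hvy⟩

/-- The barycentric refinement of a contractible link is contractible. -/
lemma contractible_starFaces {G : FGraph V} {x : Finset V} (hx : G.IsFace x)
    (h : Contractible (G.link x)) : Contractible (compGraph (G.starFaces x)) := by
  generalize hL : G.link x = L at h
  induction h generalizing G x with
  | single L v h =>
    subst hL
    have hv : v ∈ (G.link x).verts := by simp [h]
    refine contractible_of_apex _ (insert v x) (insert_mem_starFaces hx hv) fun z hz hne => ?_
    refine absurd (Finset.Subset.antisymm (fun a ha => ?_) (Finset.insert_subset ?_ ?_)) hne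
    · by_cases hax : a ∈ x
      · exact Finset.mem_insert_of_mem hax
      · have := mem_link_of_mem_starFaces hz ha hax
        rw [h, Finset.mem_singleton] at this
        simp [this]
    · obtain ⟨w, hw, hwx⟩ := Finset.exists_of_ssubset (mem_starFaces.1 hz).1
      have := mem_link_of_mem_starFaces hz hw hwx
      rw [h, Finset.mem_singleton] at this
      exact this ▸ hw
    · exact (mem_starFaces.1 hz).1.1
  | step L v hv _ _ ih1 ih2 =>
    subst hL
    have hvx := notMem_of_mem_link hv
    have hmem := insert_mem_starFaces hx hv
    refine .step _ (insert v x) hmem ?_ ?_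
    · rw [compGraph_unitSphere hmem]
      convert ih1 (hx.insert hv) (link_insert hv) using 2
      ext z
      simp only [Finset.mem_filter, mem_starFaces]
      constructor
      · rintro ⟨⟨hxz, hz⟩, h | h⟩
        · have h1 := Finset.card_lt_card hxz
          have h2 := Finset.card_lt_card h
          rw [Finset.card_insert_of_notMem hvx] at h2
          omega
        · exact ⟨h, hz⟩
      · rintro ⟨h, hz⟩
        exact ⟨⟨(Finset.subset_insert v x).trans_ssubset h, hz⟩, Or.inr h⟩
    · rw [compGraph_erase]
      exact contractible_starFaces_erase hv (ih2 (hx.erase hvx) (link_erase hvx))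

/-- The barycentric refinement of a spherical link is a sphere of the same dimension. -/
lemma isSphere_starFaces {G : FGraph V} (n : ℕ) : ∀ {x : Finset V} (_ : G.IsFace x)
    (_ : IsSphere ((n : ℤ) - 1) (G.link x)),
    IsSphere ((n : ℤ) - 1) (compGraph (G.starFaces x)) := by
  induction n using Nat.strong_induction_on with
  | _ n ih =>
    intro x hx h
    rcases isSphere_iff.1 h with ⟨hn, h⟩ | ⟨hn, hS, v, hv, hc⟩
    · refine isSphere_iff.2 (Or.inl ⟨hn, Finset.eq_empty_of_forall_notMem fun y hy => ?_⟩)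
      obtain ⟨w, hw, hwx⟩ := Finset.exists_of_ssubset (mem_starFaces.1 hy).1
      have := mem_link_of_mem_starFaces hy hw hwx
      simp [h] at this
    · refine isSphere_iff.2 (Or.inr ⟨hn, fun y hy => ?_, insert v x,
        insert_mem_starFaces hx hv, ?_⟩)
      · have hy := mem_compGraph.1 hy
        obtain ⟨hxy, hyF⟩ := mem_starFaces.1 hy
        have hlt := Finset.card_lt_card hxy
        have hl := isSphere_link_of_subset (y.card - x.card) _ x y hxy.1 hyF (by omega) h
        have hle := hl.neg_one_le
        have heq : (n : ℤ) - 1 - ((y.card - x.card : ℕ) : ℤ) =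
            ((n - (y.card - x.card) : ℕ) : ℤ) - 1 := by omega
        rw [heq] at hl
        have hup := ih (n - (y.card - x.card)) (by omega) hyF hl
        have key := isSphere_compGraph_unitSphere hy (p := (y.card : ℤ) - x.card - 2)
          (q := ((n - (y.card - x.card) : ℕ) : ℤ) - 1) ?_ ?_
        · convert key using 1; omega
        · convert isSphere_interval hxy using 2
          ext z
          rw [mem_colorFaces_intervalColor hxy, Finset.mem_filter, mem_starFaces]
          exact ⟨fun h => ⟨h.1.1, h.2⟩, fun h => ⟨⟨h.1, h.2.1.trans hyF.1,
            fun a ha b hb hab => hyF.2 a (h.2.1 ha) b (h.2.1 hb) hab⟩, h.2⟩⟩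
        · convert hup using 2
          ext z
          simp only [Finset.mem_filter, mem_starFaces]
          exact ⟨fun h => ⟨h.2, h.1.2⟩, fun h => ⟨⟨hxy.trans h.1, h.2⟩, h.1⟩⟩
      · rw [compGraph_erase]
        refine contractible_starFaces_erase hv ?_
        have hvx := notMem_of_mem_link hv
        refine contractible_starFaces (hx.erase hvx) ?_
        rwa [link_erase hvx]

lemma signValues_mono (ψ : V → ℂ) (c : ℂ) {x y : Finset V} (h : x ⊆ y) :
    signValues ψ c x ⊆ signValues ψ c y := Finset.image_subset_image h

end FGraph

lemma card_signU : signU.card = 4 := by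
  unfold signU
  repeat rw [Finset.card_insert_of_notMem]
  · simp
  all_goals
    simp [Complex.ext_iff]
    try norm_num

lemma csgn_mem_signU {z : ℂ} (h1 : z.re ≠ 0) (h2 : z.im ≠ 0) : csgn z ∈ signU := by
  rcases h1.lt_or_gt with h1 | h1 <;> rcases h2.lt_or_gt with h2 | h2 <;>
    simp [csgn, signU, Complex.ext_iff, Real.sign_of_neg, Real.sign_of_pos, h1, h2]

/-- In a four-element set, a set containing `e` and a further element contains one of the two
three-element sets above `e`. -/
lemma subset_or_subset_iff {α : Type} {U e s t₁ t₂ : Finset α} (hU : U.card = 4)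
    (hs : s ⊆ U) (he : e.card = 2) (h₁ : t₁ ⊆ U) (hc₁ : t₁.card = 3) (he₁ : e ⊆ t₁)
    (h₂ : t₂ ⊆ U) (hc₂ : t₂.card = 3) (he₂ : e ⊆ t₂) (hne : t₁ ≠ t₂) :
    t₁ ⊆ s ∨ t₂ ⊆ s ↔ e ⊆ s ∧ 3 ≤ s.card := by
  constructor
  · rintro (h | h)
    · exact ⟨he₁.trans h, hc₁ ▸ Finset.card_le_card h⟩
    · exact ⟨he₂.trans h, hc₂ ▸ Finset.card_le_card h⟩
  · rintro ⟨hes, h3⟩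
    have hlt : t₁.card < (t₁ ∪ t₂).card :=
      Finset.card_lt_card (Finset.subset_union_left.ssubset_of_ne fun h => hne.symm
        (Finset.eq_of_subset_of_card_le (h ▸ Finset.subset_union_right) (by omega)))
    have hUt : t₁ ∪ t₂ = U :=
      Finset.eq_of_subset_of_card_le (Finset.union_subset h₁ h₂) (by omega)
    obtain ⟨u, hu, hue⟩ := Finset.exists_mem_notMem_of_card_lt_card (s := e) (t := s) (by omega)
    have key : ∀ t : Finset α, t.card = 3 → e ⊆ t → u ∈ t → t ⊆ s := by
      intro t hc het hut
      have : insert u e = t := Finset.eq_of_subset_of_card_le (Finset.insert_subset hut het)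
        (by rw [Finset.card_insert_of_notMem hue]; omega)
      exact this ▸ Finset.insert_subset hu hes
    have huU := hs hu
    rw [← hUt] at huU
    exact (Finset.mem_union.1 huU).imp (key t₁ hc₁ he₁) (key t₂ hc₂ he₂)

namespace FGraph

variable {V : Type}

lemma signValues_subset_signU {G : FGraph V} {ψ : V → ℂ}
    (hψ : ∀ v ∈ G.verts, (ψ v).re ≠ 0 ∧ (ψ v).im ≠ 0) {x : Finset V} (hx : x ⊆ G.verts) :
    signValues ψ 0 x ⊆ signU := by
  intro u hu
  obtain ⟨v, hv, rfl⟩ := Finset.mem_image.1 hu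
  simpa using csgn_mem_signU (hψ v (hx hv)).1 (hψ v (hx hv)).2

lemma mem_barycentric {G : FGraph V} {x : Finset V} :
    x ∈ G.barycentric.verts ↔ G.IsSimplex x := by
  simp only [barycentric, Finset.mem_filter, Finset.mem_powerset]
  exact ⟨And.right, fun h => ⟨h.2.1, h⟩⟩

lemma signPreimage_eq_compGraph (G : FGraph V) (ψ : V → ℂ) (t : Finset ℂ) :
    G.signPreimage ψ t = compGraph (G.signPreimage ψ t).verts := by
  refine ext_of (fun _ => Iff.rfl) fun a b => ?_
  simp only [signPreimage, adj_induce, adj_compGraph, mem_induce, mem_barycentric]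
  simp only [barycentric]
  tauto

lemma union_signPreimage {G : FGraph V} {ψ : V → ℂ}
    (hψ : ∀ v ∈ G.verts, (ψ v).re ≠ 0 ∧ (ψ v).im ≠ 0) {e t₁ t₂ : Finset ℂ}
    (he : e.card = 2) (h₁ : t₁ ⊆ signU) (hc₁ : t₁.card = 3) (he₁ : e ⊆ t₁)
    (h₂ : t₂ ⊆ signU) (hc₂ : t₂.card = 3) (he₂ : e ⊆ t₂) (hne : t₁ ≠ t₂) :
    (G.signPreimage ψ t₁).union (G.signPreimage ψ t₂) = G.complexLevelSetE ψ e := by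
  have key : ∀ x, G.IsSimplex x → (t₁ ⊆ signValues ψ 0 x ∨ t₂ ⊆ signValues ψ 0 x ↔
      e ⊆ signValues ψ 0 x ∧ 3 ≤ (signValues ψ 0 x).card) := fun x hx =>
    subset_or_subset_iff card_signU (signValues_subset_signU hψ hx.2.1) he h₁ hc₁ he₁ h₂ hc₂ he₂ hne
  apply ext_of
  · intro x
    simp only [union, Finset.mem_union, signPreimage, complexLevelSetE, mem_induce,
      mem_barycentric]
    have := key x
    simp only [Finset.subset_iff] at this
    tauto
  · intro x y
    simp only [union, signPreimage, complexLevelSetE, adj_induce]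
    constructor
    · rintro (⟨h, hx, hy⟩ | ⟨h, hx, hy⟩)
      · exact ⟨h, (key x h.1).1 (Or.inl hx), (key y h.2.1).1 (Or.inl hy)⟩
      · exact ⟨h, (key x h.1).1 (Or.inr hx), (key y h.2.1).1 (Or.inr hy)⟩
    · rintro ⟨h, hx, hy⟩
      rcases h.2.2 with hxy | hxy
      · have hm := signValues_mono ψ 0 hxy.1
        exact ((key x h.1).2 hx).imp (fun ht => ⟨h, ht, Finset.Subset.trans ht hm⟩)
          fun ht => ⟨h, ht, Finset.Subset.trans ht hm⟩
      · have hm := signValues_mono ψ 0 hxy.1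
        exact ((key y h.2.1).2 hy).imp (fun ht => ⟨h, Finset.Subset.trans ht hm, ht⟩)
          fun ht => ⟨h, Finset.Subset.trans ht hm, ht⟩

lemma isManifold_signPreimage_signU {G : FGraph V} {d : ℤ} (hG : IsManifold d G) {ψ : V → ℂ}
    (hψ : ∀ v ∈ G.verts, (ψ v).re ≠ 0 ∧ (ψ v).im ≠ 0)
    (hne : (G.signPreimage ψ signU).verts.Nonempty) :
    IsManifold (d - 3) (G.signPreimage ψ signU) := by
  have hmem : ∀ x, x ∈ (G.signPreimage ψ signU).verts ↔
      G.IsSimplex x ∧ signU ⊆ signValues ψ 0 x := fun x => by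
    rw [signPreimage, mem_induce, mem_barycentric, Finset.subset_iff]
  have himg : ∀ x, x ∈ (G.signPreimage ψ signU).verts → signValues ψ 0 x = signU := fun x hx =>
    (signValues_subset_signU hψ ((hmem x).1 hx).1.2.1).antisymm ((hmem x).1 hx).2
  have hcard : ∀ x, x ∈ (G.signPreimage ψ signU).verts → 4 ≤ x.card := fun x hx => by
    rw [← card_signU, ← himg x hx]
    exact Finset.card_image_le
  obtain ⟨x₀, hx₀⟩ := hne
  have hd : 0 ≤ d - 3 := by
    have h1 := (hG.isSphere_link ((hmem x₀).1 hx₀).1).neg_one_le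
    have h2 := hcard x₀ hx₀
    omega
  refine .intro _ hd _ fun x hx => ?_
  have hsx := ((hmem x).1 hx).1
  have h4 := hcard x hx
  obtain ⟨k, hk⟩ := Nat.exists_eq_add_of_le h4
  have hl := hG.isSphere_link hsx
  have hle := hl.neg_one_le
  obtain ⟨n, hn⟩ := Int.eq_ofNat_of_zero_le (a := d - x.card + 1) (by omega)
  rw [show d - x.card = (n : ℤ) - 1 by omega] at hl
  have hup := isSphere_starFaces n hsx.2 hl
  have hlow := isSphere_colorFaces k (fun v => csgn (ψ v - 0)) x (by
    have := himg x hx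
    unfold signValues at this
    rw [this, card_signU, hk])
  rw [signPreimage_eq_compGraph]
  have key := isSphere_compGraph_unitSphere hx (p := (k : ℤ) - 1) (q := (n : ℤ) - 1) ?_ ?_
  · convert key using 1; omega
  · convert hlow using 2
    ext z
    rw [Finset.mem_filter, hmem, mem_colorFaces]
    constructor
    · rintro ⟨⟨_, h⟩, hzx⟩
      refine ⟨hzx.1, hzx.ne, fun a ha => Finset.mem_image.1 (h ?_)⟩
      rw [← himg x hx]
      exact Finset.mem_image_of_mem _ ha
    · rintro ⟨h1, h2, h3⟩
      refine ⟨⟨⟨?_, h1.trans hsx.2.1, fun a ha b hb hab =>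
        hsx.2.2 a (h1 ha) b (h1 hb) hab⟩, ?_⟩, h1.ssubset_of_ne h2⟩
      · obtain ⟨a, ha⟩ := hsx.1
        obtain ⟨b, hb, -⟩ := h3 a ha
        exact ⟨b, hb⟩
      · rw [← himg x hx]
        intro u hu
        obtain ⟨a, ha, rfl⟩ := Finset.mem_image.1 hu
        exact Finset.mem_image.2 (h3 a ha)
  · convert hup using 2
    ext z
    rw [Finset.mem_filter, hmem, mem_starFaces]
    constructor
    · rintro ⟨⟨h, _⟩, hxz⟩
      exact ⟨hxz, h.2⟩
    · rintro ⟨hxz, h⟩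
      exact ⟨⟨⟨hsx.1.mono hxz.1, h⟩,
        ((hmem x).1 hx).2.trans (signValues_mono ψ 0 hxz.1)⟩, hxz⟩

end FGraph

/-- Let `G` be a `d`-manifold, `ψ : V → ℂ` with nowhere-vanishing real and
imaginary parts on `V`, `e` a 2-element subset of `U = {1+i,1-i,-1+i,-1-i}` and `t1, t2`
the two 3-element subsets of `U` containing `e`. Then (i) the union of `Ψ^{-1}(t1)` and
`Ψ^{-1}(t2)` equals the level set `{ψ = 0}_e`, and (ii) their intersection, the subgraph
induced by the simplices on which `sign(ψ)` attains all four values of `U`, is either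
the empty graph or a `(d-3)`-manifold. -/
theorem sign_preimage_union_and_intersection {V : Type} (G : FGraph V) (d : ℤ)
    (hG : FGraph.IsManifold d G) (ψ : V → ℂ)
    (hψ : ∀ v ∈ G.verts, (ψ v).re ≠ 0 ∧ (ψ v).im ≠ 0)
    (e t1 t2 : Finset ℂ) (he : e ⊆ signU) (hec : e.card = 2)
    (ht1 : t1 ⊆ signU) (ht1c : t1.card = 3) (het1 : e ⊆ t1)
    (ht2 : t2 ⊆ signU) (ht2c : t2.card = 3) (het2 : e ⊆ t2) (hne : t1 ≠ t2) :
    FGraph.union (G.signPreimage ψ t1) (G.signPreimage ψ t2) = G.complexLevelSetE ψ e ∧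
    ((G.signPreimage ψ signU).verts = ∅ ∨
      FGraph.IsManifold (d - 3) (G.signPreimage ψ signU)) := by
  refine ⟨FGraph.union_signPreimage hψ hec ht1 ht1c het1 ht2 ht2c het2 hne, ?_⟩
  rcases Finset.eq_empty_or_nonempty (G.signPreimage ψ signU).verts with h | h
  · exact Or.inl h
  · exact Or.inr (FGraph.isManifold_signPreimage_signU hG hψ h)
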